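/- For every n, a subset of ℝⁿ is ℚ-semi-algebraic if and only if it is 𝔔-semi-algebraic, where 𝔔 = ℚ̄ ∩ ℝ denotes the field of real algebraic numbers. -/

import Mathlib

open MeasureTheory

/-- The Boolean algebra of subsets of `ℝⁿ` generated by the sets
`{x | p(x) > 0}` for polynomials `p` with coefficients in `F ⊆ ℝ`. -/
inductive IsSemiAlgebraic (F : Set ℝ) : (n : ℕ) → Set (Fin n → ℝ) → Prop
  | basic (n : ℕ) (p : MvPolynomial (Fin n) ℝ) (hp : ∀ m, MvPolynomial.coeff m p ∈ F) :
      IsSemiAlgebraic F n {x | 0 < MvPolynomial.eval x p}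
  | compl (n : ℕ) (s : Set (Fin n → ℝ)) :
      IsSemiAlgebraic F n s → IsSemiAlgebraic F n sᶜ
  | union (n : ℕ) (s t : Set (Fin n → ℝ)) :
      IsSemiAlgebraic F n s → IsSemiAlgebraic F n t → IsSemiAlgebraic F n (s ∪ t)

/-- The rational numbers, viewed as a subset of `ℝ`. -/
def ratCoeffs : Set ℝ := Set.range ((↑) : ℚ → ℝ)
/-- The real algebraic numbers, viewed as a subset of `ℝ`: `𝔔 = ℚ̄ ∩ ℝ`. -/
def realAlgCoeffs : Set ℝ := {x : ℝ | IsAlgebraic ℚ x}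

namespace Polynomial

lemma eraseLead_comp_neg_X {R : Type*} [CommRing R] [IsDomain R] (P : R[X]) :
    (P.comp (-X)).eraseLead = P.eraseLead.comp (-X) := by
  rw [← self_sub_C_mul_X_pow, ← self_sub_C_mul_X_pow P, comp_neg_X_leadingCoeff_eq,
    natDegree_comp, natDegree_neg, natDegree_X, mul_one, sub_comp, mul_comp, C_comp, X_pow_comp,
    neg_pow (X : R[X]), C_mul, C_pow, C_neg, C_1]
  ring

lemma signVariations_add_signVariations_comp_neg_X_le (P : ℝ[X]) (hP : P ≠ 0) :
    P.signVariations + (P.comp (-X)).signVariations + P.natTrailingDegree ≤ P.natDegree := by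
  induction h : P.natDegree using Nat.strong_induction_on generalizing P with
  | _ d ih =>
  subst h
  have hP' : P.comp (-X) ≠ 0 := by
    rw [← leadingCoeff_ne_zero, comp_neg_X_leadingCoeff_eq]
    simpa using hP
  rw [signVariations_eq_eraseLead_add_ite hP, signVariations_eq_eraseLead_add_ite hP',
    eraseLead_comp_neg_X, comp_neg_X_leadingCoeff_eq, comp_neg_X_leadingCoeff_eq]
  by_cases hQ : P.eraseLead = 0
  · simp [hQ, hP, natTrailingDegree_le_natDegree]
  have hdeg : P.eraseLead.natDegree < P.natDegree := by
    apply eraseLead_natDegree_lt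
    by_contra! hcard
    have := eraseLead_support_card_lt hP
    exact hQ (card_support_eq_zero.1 (by omega))
  have htrail : P.natTrailingDegree ≤ P.eraseLead.natTrailingDegree := by
    apply natTrailingDegree_le_of_ne_zero
    have h1 : P.eraseLead.coeff P.eraseLead.natTrailingDegree ≠ 0 := by
      simpa [trailingCoeff] using trailingCoeff_nonzero_iff_nonzero.2 hQ
    have h2 := natTrailingDegree_le_natDegree P.eraseLead
    rwa [eraseLead_coeff_of_ne _ (by omega)] at h1
  have key := ih _ hdeg _ hQ rfl
  rcases Nat.lt_or_ge (P.eraseLead.natDegree + 1) P.natDegree with hlt | hge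
  · split_ifs <;> omega
  have hd : P.natDegree = P.eraseLead.natDegree + 1 := by omega
  have hex : ¬ (SignType.sign P.leadingCoeff = -SignType.sign P.eraseLead.leadingCoeff ∧
      SignType.sign ((-1) ^ P.natDegree * P.leadingCoeff) =
        -SignType.sign ((-1) ^ P.eraseLead.natDegree * P.eraseLead.leadingCoeff)) := by
    rintro ⟨h1, h2⟩
    rw [hd, pow_succ, sign_mul, sign_mul, sign_mul, h1] at h2
    have h3 : SignType.sign ((-1 : ℝ) ^ P.eraseLead.natDegree) ≠ 0 := by simp
    have h4 : SignType.sign P.eraseLead.leadingCoeff ≠ 0 := by simpa using hQ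
    have h5 : SignType.sign (-1 : ℝ) = -1 := by simp
    rw [h5] at h2
    revert h2 h3 h4
    generalize SignType.sign ((-1 : ℝ) ^ P.eraseLead.natDegree) = a
    generalize SignType.sign P.eraseLead.leadingCoeff = b
    revert a b
    decide
  split_ifs with h1 h2 <;> first | omega | exact absurd ⟨h1, h2⟩ hex

/-- Descartes' rule of signs is exact for real polynomials with only real roots. -/
theorem Splits.roots_countP_pos_eq_signVariations {P : ℝ[X]} (hP : P ≠ 0) (h : P.Splits) :
    P.roots.countP (0 < ·) = P.signVariations := by
  refine le_antisymm (roots_countP_pos_le_signVariations P) ?_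
  have hneg := roots_countP_pos_le_signVariations (P.comp (-X))
  rw [roots_comp_neg_X, Multiset.countP_map] at hneg
  have hzero : P.roots.countP (0 = ·) = P.natTrailingDegree := by
    rw [← rootMultiplicity_eq_natTrailingDegree', ← count_roots]
    rfl
  have hcard : P.roots.card = P.natDegree := splits_iff_card_roots.1 h
  have htotal : P.roots.countP (0 < ·) + P.roots.countP (0 < -·) + P.roots.countP (0 = ·) =
      P.roots.card := by
    induction P.roots using Multiset.induction_on with
    | empty => simp
    | cons a s ih =>
      simp only [Multiset.countP_cons, Multiset.card_cons, neg_pos] at ih ⊢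
      rcases lt_trichotomy 0 a with ha | rfl | ha
      · simp only [ha, ha.not_gt, ha.ne, if_true, if_false]
        omega
      · simp only [lt_irrefl, if_true, if_false]
        omega
      · simp only [ha, ha.not_gt, ha.ne', if_true, if_false]
        omega
  have := signVariations_add_signVariations_comp_neg_X_le P hP
  rw [← Multiset.countP_eq_card_filter] at hneg
  omega

lemma signVariations_congr {P Q : ℝ[X]}
    (h : ∀ i, SignType.sign (P.coeff i) = SignType.sign (Q.coeff i)) :
    P.signVariations = Q.signVariations := by
  have hdeg : P.degree = Q.degree := by
    have hsupp : P.support = Q.support := by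
      ext i
      rw [mem_support_iff, mem_support_iff, ← sign_ne_zero, h i, sign_ne_zero]
    rw [degree, degree, hsupp]
  simp only [signVariations, coeffList, hdeg, List.map_map]
  rw [show SignType.sign ∘ P.coeff = SignType.sign ∘ Q.coeff from _root_.funext h]

end Polynomial

namespace Matrix

variable {ι : Type*} [Fintype ι] [DecidableEq ι]

lemma toQuadraticForm'_apply {R : Type*} [CommRing R] (A : Matrix ι ι R) (v : ι → R) :
    A.toQuadraticForm' v = v ⬝ᵥ A *ᵥ v := by
  simp [toQuadraticForm', toLinearMap₂'_apply']

theorem IsHermitian.sigPos_eq_signVariations_charpoly {A : Matrix ι ι ℝ} (hA : A.IsHermitian) :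
    sigPos A.toQuadraticForm' = A.charpoly.signVariations := by
  rw [← hA.splits_charpoly.roots_countP_pos_eq_signVariations A.charpoly_monic.ne_zero,
    hA.roots_charpoly_eq_eigenvalues, Multiset.countP_map]
  let U : Matrix ι ι ℝ := hA.eigenvectorUnitary
  have hU : U * star U = 1 := Unitary.coe_mul_star_self hA.eigenvectorUnitary
  have hU' : star U * U = 1 := Unitary.coe_star_mul_self hA.eigenvectorUnitary
  have hspec : A = U * diagonal hA.eigenvalues * star U := by
    simpa [Unitary.conjStarAlgAut_apply] using hA.spectral_theorem
  let e : (ι → ℝ) ≃ₗ[ℝ] (ι → ℝ) := toLin'OfInv hU hU'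
  rw [QuadraticForm.sigPos_of_equiv_weightedSumSquares (w := hA.eigenvalues)
    ⟨{ e with map_app' := fun v => ?_ }⟩]
  · rw [Set.ncard_eq_toFinset_card']
    simp [Finset.card_def]
  · have he : ∀ v, e v = star U *ᵥ v := fun v => toLin'_apply (star U) v
    change QuadraticMap.weightedSumSquares ℝ hA.eigenvalues (e v) = _
    rw [toQuadraticForm'_apply, he]
    conv_rhs => rw [hspec, ← mulVec_mulVec, ← mulVec_mulVec, dotProduct_mulVec, ← mulVec_transpose]
    simp [dotProduct, mulVec_diagonal, star_eq_conjTranspose, conjTranspose_eq_transpose_of_trivial]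
    exact Finset.sum_congr rfl fun i _ => by ring

end Matrix

section TraceForm

open Module

variable {K ι : Type*} [Field K] [Algebra ℚ K] [Fintype ι] (b : Basis ι ℚ K)

/-- The `ℝ`-linear extension to `ℝ ⊗ K`, in coordinates with respect to `b`, of an embedding
`σ : K → ℂ`. -/
noncomputable def realExtension (σ : K →ₐ[ℚ] ℂ) : (ι → ℝ) →ₗ[ℝ] ℂ :=
  Fintype.linearCombination ℝ fun i => σ (b i)

lemma realExtension_apply (σ : K →ₐ[ℚ] ℂ) (v : ι → ℝ) :
    realExtension b σ v = ∑ i, (v i : ℂ) * σ (b i) := by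
  simp [realExtension, Fintype.linearCombination_apply]

/-- The Gram matrix of the form `v ↦ Tr (y * v ^ 2)` on `ℝ ⊗ K`, in coordinates with respect
to `b`. -/
noncomputable def scaledTraceMatrix (y : ι → ℝ) : Matrix ι ι ℝ :=
  Matrix.of fun i j => ∑ k, y k * (Algebra.trace ℚ K (b k * b i * b j) : ℝ)

lemma isHermitian_scaledTraceMatrix (y : ι → ℝ) : (scaledTraceMatrix b y).IsHermitian := by
  ext i j
  simp [scaledTraceMatrix, mul_right_comm]

/-- Composition of an embedding with complex conjugation. -/
noncomputable def conjEmbedding (σ : K →ₐ[ℚ] ℂ) : K →ₐ[ℚ] ℂ :=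
  (Complex.conjAe.toAlgHom.restrictScalars ℚ).comp σ

lemma conjEmbedding_apply (σ : K →ₐ[ℚ] ℂ) (z : K) :
    conjEmbedding σ z = (starRingEnd ℂ) (σ z) := rfl

lemma conjEmbedding_involutive : Function.Involutive (conjEmbedding (K := K)) := fun σ => by
  ext z
  simp [conjEmbedding_apply]

lemma realExtension_conjEmbedding (σ : K →ₐ[ℚ] ℂ) (v : ι → ℝ) :
    realExtension b (conjEmbedding σ) v = (starRingEnd ℂ) (realExtension b σ v) := by
  simp [realExtension_apply, conjEmbedding_apply]

lemma conjEmbedding_eq_self {θ : K} (hθ : Function.Injective fun σ : K →ₐ[ℚ] ℂ => σ θ)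
    {σ : K →ₐ[ℚ] ℂ} (h : (σ θ).im = 0) : conjEmbedding σ = σ :=
  hθ (Complex.conj_eq_iff_im.2 h)

lemma realExtension_im_eq_zero {θ : K} (hθ : Function.Injective fun σ : K →ₐ[ℚ] ℂ => σ θ)
    {σ : K →ₐ[ℚ] ℂ} (h : (σ θ).im = 0) (v : ι → ℝ) : (realExtension b σ v).im = 0 := by
  rw [← Complex.conj_eq_iff_im, ← realExtension_conjEmbedding, conjEmbedding_eq_self hθ h]

variable [FiniteDimensional ℚ K]

lemma ratCast_trace_eq_sum (z : K) : ((Algebra.trace ℚ K z : ℚ) : ℂ) = ∑ σ : K →ₐ[ℚ] ℂ, σ z := by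
  simpa using trace_eq_sum_embeddings (K := ℚ) (L := K) ℂ (x := z)

lemma scaledTraceMatrix_toQuadraticForm' [DecidableEq ι] (y v : ι → ℝ) :
    (((scaledTraceMatrix b y).toQuadraticForm' v : ℝ) : ℂ) =
      ∑ σ : K →ₐ[ℚ] ℂ, realExtension b σ y * realExtension b σ v ^ 2 := by
  simp only [Matrix.toQuadraticForm'_apply, dotProduct, Matrix.mulVec, scaledTraceMatrix,
    Matrix.of_apply, realExtension_apply, pow_two, Complex.ofReal_sum, Complex.ofReal_mul,
    Complex.ofReal_ratCast, ratCast_trace_eq_sum, Finset.sum_mul, Finset.mul_sum, map_mul]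
  simp_rw [Finset.sum_comm (s := (Finset.univ : Finset ι))
    (t := (Finset.univ : Finset (K →ₐ[ℚ] ℂ)))]
  refine Finset.sum_congr rfl fun σ _ => ?_
  exact Finset.sum_congr rfl fun i _ => Finset.sum_congr rfl fun j _ =>
    Finset.sum_congr rfl fun k _ => by ring

lemma eq_zero_of_realExtension_eq_zero {v : ι → ℝ}
    (h : ∀ σ : K →ₐ[ℚ] ℂ, realExtension b σ v = 0) : v = 0 := by
  classical
  have hdet := det_traceForm_ne_zero b
  apply Matrix.eq_zero_of_mulVec_eq_zero (M := (LinearMap.BilinForm.toMatrix b (Algebra.traceForm ℚ K)).map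
    (algebraMap ℚ ℝ))
  · rw [← RingHom.mapMatrix_apply, ← RingHom.map_det]
    simpa using hdet
  · ext j
    apply Complex.ofReal_injective
    have : ∑ σ : K →ₐ[ℚ] ℂ, σ (b j) * realExtension b σ v = 0 := by simp [h]
    simp only [realExtension_apply, Finset.mul_sum] at this
    rw [Finset.sum_comm] at this
    simp only [Matrix.mulVec, dotProduct, Matrix.map_apply, LinearMap.BilinForm.toMatrix_apply,
      Algebra.traceForm_apply, eq_ratCast, Complex.ofReal_sum, Complex.ofReal_mul,
      Complex.ofReal_ratCast, ratCast_trace_eq_sum, Pi.zero_apply, Complex.ofReal_zero,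
      map_mul, Finset.sum_mul]
    rw [← this]
    exact Finset.sum_congr rfl fun i _ => Finset.sum_congr rfl fun σ _ => by ring

lemma sum_eq_zero_of_conjEmbedding_neg {D : (K →ₐ[ℚ] ℂ) → ℝ}
    (hD : ∀ σ, D (conjEmbedding σ) = -D σ) : ∑ σ, D σ = 0 := by
  have h := Equiv.sum_comp conjEmbedding_involutive.toPerm D
  simp only [Function.Involutive.coe_toPerm, hD, Finset.sum_neg_distrib] at h
  linarith

/-- A complex square root, replaced by `1` at `0`. -/
lemma exists_sq_eq_ite (z : ℂ) : ∃ r : ℂ, r ≠ 0 ∧ z = (if z = 0 then 0 else 1) * r ^ 2 := by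
  by_cases hz : z = 0
  · exact ⟨1, one_ne_zero, by simp [hz]⟩
  · obtain ⟨r, hr⟩ := IsAlgClosed.exists_pow_nat_eq z two_pos
    refine ⟨r, ?_, by simp [hz, hr]⟩
    rintro rfl
    simp_all

/-- Signature of the trace form `v ↦ Tr (y * v ^ 2)`: each real embedding contributes the sign
of `y`, each pair of conjugate complex embeddings contributes a hyperbolic plane unless `y`
vanishes there. -/
theorem sigPos_scaledTraceMatrix [DecidableEq ι] {θ : K}
    (hθ : Function.Injective fun σ : K →ₐ[ℚ] ℂ => σ θ) (y : ι → ℝ) :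
    sigPos (scaledTraceMatrix b y).toQuadraticForm' =
      {σ : K →ₐ[ℚ] ℂ | ((σ θ).im = 0 ∧ 0 < (realExtension b σ y).re) ∨
        (0 < (σ θ).im ∧ realExtension b σ y ≠ 0)}.ncard := by
  classical
  choose r hr0 hr using fun σ : K →ₐ[ℚ] ℂ => exists_sq_eq_ite (realExtension b σ y)
  let c : (K →ₐ[ℚ] ℂ) → ℝ := fun σ => if realExtension b σ y = 0 then 0 else 1
  have hc : ∀ σ, c (conjEmbedding σ) = c σ := fun σ => by
    simp [c, realExtension_conjEmbedding]
  let w : (K →ₐ[ℚ] ℂ) → ℝ := fun σ =>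
    if (σ θ).im = 0 then (realExtension b σ y).re
    else if 0 < (σ θ).im then 2 * c σ else -2 * c σ
  let u : (K →ₐ[ℚ] ℂ) → (ι → ℝ) →ₗ[ℝ] ℂ := fun σ => r σ • realExtension b σ
  let ℓ : (K →ₐ[ℚ] ℂ) → (ι → ℝ) →ₗ[ℝ] ℝ := fun σ =>
    if (σ θ).im = 0 then Complex.reLm ∘ₗ realExtension b σ
    else if 0 < (σ θ).im then Complex.reLm ∘ₗ u σ else Complex.imLm ∘ₗ u (conjEmbedding σ)
  have him : ∀ σ : K →ₐ[ℚ] ℂ, (conjEmbedding σ θ).im = -(σ θ).im := fun σ => by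
    simp [conjEmbedding_apply]
  have hreal : ∀ σ : K →ₐ[ℚ] ℂ, (σ θ).im = 0 → ∀ v,
      ℓ σ v = (realExtension b σ v).re := fun σ h v => by simp [ℓ, h]
  have hpos : ∀ σ : K →ₐ[ℚ] ℂ, 0 < (σ θ).im → ∀ v, ℓ σ v = (u σ v).re := fun σ h v => by
    simp [ℓ, h, h.ne']
  have hneg : ∀ σ : K →ₐ[ℚ] ℂ, 0 < (σ θ).im → ∀ v,
      ℓ (conjEmbedding σ) v = (u σ v).im := fun σ h v => by
    simp [ℓ, him, h.ne', h.not_gt, conjEmbedding_involutive σ]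
  have hsq : ∀ σ v, (realExtension b σ y * realExtension b σ v ^ 2).re =
      c σ * ((u σ v).re ^ 2 - (u σ v).im ^ 2) := fun σ v => by
    have : realExtension b σ y * realExtension b σ v ^ 2 = (c σ : ℂ) * (u σ v) ^ 2 := by
      conv_lhs => rw [hr σ]
      simp only [u, c, LinearMap.smul_apply, smul_eq_mul]
      split_ifs <;> simp; ring
    rw [this, Complex.re_ofReal_mul, pow_two, Complex.mul_re]
    ring
  let L : (ι → ℝ) →ₗ[ℝ] ((K →ₐ[ℚ] ℂ) → ℝ) := LinearMap.pi ℓ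
  have hinj : Function.Injective L := by
    rw [← LinearMap.ker_eq_bot, LinearMap.ker_eq_bot']
    intro v hv
    have hv' : ∀ σ, ℓ σ v = 0 := fun σ => congrFun hv σ
    have hup : ∀ σ : K →ₐ[ℚ] ℂ, 0 < (σ θ).im → realExtension b σ v = 0 := fun σ h => by
      have : u σ v = 0 := Complex.ext (by rw [← hpos σ h, hv', Complex.zero_re])
        (by rw [← hneg σ h, hv', Complex.zero_im])
      simpa [u, hr0 σ] using this
    refine eq_zero_of_realExtension_eq_zero b fun σ => ?_
    rcases lt_trichotomy 0 (σ θ).im with h | h | h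
    · exact hup σ h
    · exact Complex.ext (by rw [← hreal σ h.symm, hv', Complex.zero_re])
        (realExtension_im_eq_zero b hθ h.symm v)
    · have := hup (conjEmbedding σ) (by rw [him]; linarith)
      simpa [realExtension_conjEmbedding] using this
  have hfin : finrank ℝ (ι → ℝ) = finrank ℝ ((K →ₐ[ℚ] ℂ) → ℝ) := by
    rw [finrank_fintype_fun_eq_card, finrank_fintype_fun_eq_card, AlgHom.card,
      finrank_eq_card_basis b]
  have hform : ∀ v, QuadraticMap.weightedSumSquares ℝ w (L v) =
      (scaledTraceMatrix b y).toQuadraticForm' v := fun v => by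
    have h1 := congrArg Complex.re (scaledTraceMatrix_toQuadraticForm' b y v)
    rw [Complex.ofReal_re, Complex.re_sum] at h1
    rw [h1, QuadraticMap.weightedSumSquares_apply, ← sub_eq_zero, ← Finset.sum_sub_distrib]
    refine sum_eq_zero_of_conjEmbedding_neg fun σ => ?_
    have hLv : ∀ σ, L v σ = ℓ σ v := fun σ => rfl
    have main : ∀ σ : K →ₐ[ℚ] ℂ, 0 < (σ θ).im →
        w (conjEmbedding σ) • (L v (conjEmbedding σ) * L v (conjEmbedding σ)) -
          (realExtension b (conjEmbedding σ) y * realExtension b (conjEmbedding σ) v ^ 2).re =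
        -(w σ • (L v σ * L v σ) - (realExtension b σ y * realExtension b σ v ^ 2).re) := by
      intro σ h
      have hwn : w (conjEmbedding σ) = -2 * c σ := by simp [w, him, hc, h.ne', h.le]
      have hwp : w σ = 2 * c σ := by simp [w, h.ne', h]
      have hconj : (realExtension b (conjEmbedding σ) y *
          realExtension b (conjEmbedding σ) v ^ 2).re =
          (realExtension b σ y * realExtension b σ v ^ 2).re := by
        rw [realExtension_conjEmbedding, realExtension_conjEmbedding, ← map_pow, ← map_mul,
          Complex.conj_re]
      rw [hconj, hsq, hwn, hwp, hLv, hLv, hneg σ h, hpos σ h]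
      simp only [smul_eq_mul]
      ring
    rcases lt_trichotomy 0 (σ θ).im with h | h | h
    · exact main σ h
    · rw [conjEmbedding_eq_self hθ h.symm]
      have hw : w σ = (realExtension b σ y).re := by simp [w, h.symm]
      have hv := realExtension_im_eq_zero b hθ h.symm v
      rw [hLv, hreal σ h.symm, hw, pow_two, Complex.mul_re, Complex.mul_re, Complex.mul_im, hv]
      simp
    · have := main (conjEmbedding σ) (by rw [him]; linarith)
      rw [conjEmbedding_involutive σ] at this
      linarith
  let e := LinearEquiv.ofBijective L
    ⟨hinj, (LinearMap.injective_iff_surjective_of_finrank_eq_finrank hfin).1 hinj⟩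
  rw [QuadraticForm.sigPos_of_equiv_weightedSumSquares (w := w) ⟨{ e with map_app' := hform }⟩]
  congr 1
  ext σ
  simp only [Set.mem_ofPred_eq, w, c]
  split_ifs with h1 h2 h3 h3
  · simp [h1]
  · simp [h1, h3]
  · simp [h1, h2, h3]
  · simp [h1, h3]
  · simp [h1, h2]

end TraceForm

section SemiAlgebraic

variable {F : Set ℝ} {n : ℕ}

lemma IsSemiAlgebraic.mono {G : Set ℝ} (hFG : F ⊆ G) {s : Set (Fin n → ℝ)}
    (hs : IsSemiAlgebraic F n s) : IsSemiAlgebraic G n s := by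
  induction hs with
  | basic p hp => exact .basic n p fun m => hFG (hp m)
  | compl s _ ih => exact .compl n s ih
  | union s t _ _ ihs iht => exact .union n s t ihs iht

lemma IsSemiAlgebraic.inter {s t : Set (Fin n → ℝ)} (hs : IsSemiAlgebraic F n s)
    (ht : IsSemiAlgebraic F n t) : IsSemiAlgebraic F n (s ∩ t) := by
  rw [← compl_compl (s ∩ t), Set.compl_inter]
  exact .compl _ _ (.union _ _ _ (.compl _ _ hs) (.compl _ _ ht))

/-- A rational polynomial, viewed as a real one, defines a `ℚ`-semi-algebraic positivity set. -/
lemma isSemiAlgebraic_rat_pos (g : MvPolynomial (Fin n) ℚ) :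
    IsSemiAlgebraic ratCoeffs n {x | 0 < MvPolynomial.aeval x g} := by
  convert! IsSemiAlgebraic.basic (F := ratCoeffs) n (MvPolynomial.map (algebraMap ℚ ℝ) g) ?_ using 3
  · rw [MvPolynomial.eval_map, MvPolynomial.aeval_def]
  · intro m
    rw [MvPolynomial.coeff_map]
    exact ⟨_, rfl⟩

lemma isSemiAlgebraic_rat_empty : IsSemiAlgebraic ratCoeffs n ∅ := by
  simpa using isSemiAlgebraic_rat_pos (n := n) 0

lemma isSemiAlgebraic_rat_univ : IsSemiAlgebraic ratCoeffs n Set.univ := by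
  simpa using IsSemiAlgebraic.compl _ _ (isSemiAlgebraic_rat_empty (n := n))

lemma isSemiAlgebraic_rat_biUnion {ι : Type*} (t : Finset ι) {s : ι → Set (Fin n → ℝ)}
    (h : ∀ i ∈ t, IsSemiAlgebraic ratCoeffs n (s i)) :
    IsSemiAlgebraic ratCoeffs n (⋃ i ∈ t, s i) := by
  classical
  induction t using Finset.induction_on with
  | empty => simpa using isSemiAlgebraic_rat_empty
  | insert a t _ ih =>
    rw [Finset.set_biUnion_insert]
    exact .union _ _ _ (h a (by simp)) (ih fun i hi => h i (by simp [hi]))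

lemma isSemiAlgebraic_rat_biInter {ι : Type*} (t : Finset ι) {s : ι → Set (Fin n → ℝ)}
    (h : ∀ i ∈ t, IsSemiAlgebraic ratCoeffs n (s i)) :
    IsSemiAlgebraic ratCoeffs n (⋂ i ∈ t, s i) := by
  classical
  induction t using Finset.induction_on with
  | empty => simpa using isSemiAlgebraic_rat_univ
  | insert a t _ ih =>
    rw [Finset.set_biInter_insert]
    exact (h a (by simp)).inter (ih fun i hi => h i (by simp [hi]))

lemma isSemiAlgebraic_rat_sign_eq (g : MvPolynomial (Fin n) ℚ) (ε : SignType) :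
    IsSemiAlgebraic ratCoeffs n {x | SignType.sign (MvPolynomial.aeval x g : ℝ) = ε} := by
  have hneg : IsSemiAlgebraic ratCoeffs n {x | (MvPolynomial.aeval x g : ℝ) < 0} := by
    simpa using isSemiAlgebraic_rat_pos (-g)
  cases ε with
  | pos => simpa [sign_eq_one_iff] using isSemiAlgebraic_rat_pos g
  | neg => simpa [sign_eq_neg_one_iff] using hneg
  | zero =>
    convert! IsSemiAlgebraic.inter (.compl _ _ (isSemiAlgebraic_rat_pos g))
      (.compl _ _ hneg) using 1
    ext x
    simp [le_antisymm_iff]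

/-- A set whose membership depends only on the signs of finitely many rational polynomials is
`ℚ`-semi-algebraic. -/
lemma isSemiAlgebraic_rat_of_sign {ι : Type*} [Finite ι] (g : ι → MvPolynomial (Fin n) ℚ)
    {s : Set (Fin n → ℝ)}
    (hs : ∀ x ∈ s, ∀ x', (∀ i, SignType.sign (MvPolynomial.aeval x (g i) : ℝ) =
      SignType.sign (MvPolynomial.aeval x' (g i) : ℝ)) → x' ∈ s) :
    IsSemiAlgebraic ratCoeffs n s := by
  classical
  cases nonempty_fintype ι
  let sgn : (Fin n → ℝ) → ι → SignType := fun x i =>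
    SignType.sign (MvPolynomial.aeval x (g i) : ℝ)
  have hset : s = ⋃ ε ∈ (sgn '' s).toFinset, ⋂ i ∈ (Finset.univ : Finset ι),
      {x | SignType.sign (MvPolynomial.aeval x (g i) : ℝ) = ε i} := by
    ext x'
    simp only [Set.mem_toFinset, Set.mem_iUnion, Set.mem_iInter, Finset.mem_univ, true_imp_iff,
      Set.mem_ofPred_eq, exists_prop, Set.exists_mem_image]
    exact ⟨fun h => ⟨x', h, fun i => rfl⟩, fun ⟨x, hx, h⟩ => hs x hx x' fun i => (h i).symm⟩
  rw [hset]
  exact isSemiAlgebraic_rat_biUnion _ fun ε _ => isSemiAlgebraic_rat_biInter _ fun i _ =>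
    isSemiAlgebraic_rat_sign_eq (g i) (ε i)

end SemiAlgebraic

section SignDetermination

open Module MvPolynomial

variable {K ι : Type*} [Field K] [Algebra ℚ K] {n : ℕ}

/-- The coordinates, with respect to a `ℚ`-basis of `K`, of a polynomial with coefficients
in `K`. -/
noncomputable def coordPolynomial (b : Basis ι ℚ K) (G : MvPolynomial (Fin n) K) (k : ι) :
    MvPolynomial (Fin n) ℚ :=
  ∑ m ∈ G.support, monomial m (b.repr (coeff m G) k)

lemma realExtension_coordPolynomial [Fintype ι] (b : Basis ι ℚ K) (G : MvPolynomial (Fin n) K)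
    (σ : K →ₐ[ℚ] ℂ) (x : Fin n → ℝ) :
    realExtension b σ (fun k => aeval x (coordPolynomial b G k)) =
      eval₂ (σ : K →+* ℂ) (fun i => (x i : ℂ)) G := by
  simp only [realExtension_apply, coordPolynomial, map_sum, aeval_monomial, eval₂_eq',
    Complex.ofReal_sum, Finset.sum_mul]
  rw [Finset.sum_comm]
  refine Finset.sum_congr rfl fun m _ => ?_
  conv_rhs => rw [← b.sum_repr (coeff m G)]
  simp only [RingHom.coe_coe, map_sum, Finset.sum_mul, Algebra.smul_def, map_mul]
  refine Finset.sum_congr rfl fun k _ => ?_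
  simp [Finsupp.prod_fintype]
  ring

/-- The matrix of rational polynomials specializing to the Gram matrix of
`v ↦ Tr (G(x) * v ^ 2)`. -/
noncomputable def traceMatrixPolynomial [Fintype ι] (b : Basis ι ℚ K)
    (G : MvPolynomial (Fin n) K) : Matrix ι ι (MvPolynomial (Fin n) ℚ) :=
  Matrix.of fun i j => ∑ k, coordPolynomial b G k * C (Algebra.trace ℚ K (b k * b i * b j))

lemma traceMatrixPolynomial_map [Fintype ι] (b : Basis ι ℚ K) (G : MvPolynomial (Fin n) K)
    (x : Fin n → ℝ) :
    (traceMatrixPolynomial b G).map (aeval x : MvPolynomial (Fin n) ℚ →ₐ[ℚ] ℝ).toRingHom =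
      scaledTraceMatrix b fun k => aeval x (coordPolynomial b G k) := by
  ext i j
  simp [traceMatrixPolynomial, scaledTraceMatrix]

variable [FiniteDimensional ℚ K]

lemma exists_neg_at_pos_elsewhere {θ : K}
    (hθ : Function.Injective fun σ : K →ₐ[ℚ] ℂ => σ θ) {σ₀ : K →ₐ[ℚ] ℂ} (h₀ : (σ₀ θ).im = 0) :
    ∃ h : K, (σ₀ h).re < 0 ∧ ∀ σ : K →ₐ[ℚ] ℂ, σ ≠ σ₀ →
      ((σ θ).im = 0 → 0 < (σ h).re) ∧ ((σ θ).im ≠ 0 → σ h ≠ 0) := by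
  obtain ⟨ε, hε, hsep⟩ : ∃ ε > 0, ∀ σ : K →ₐ[ℚ] ℂ, σ ≠ σ₀ → (σ θ).im = 0 →
      ε ≤ |(σ θ).re - (σ₀ θ).re| := by
    classical
    by_cases hne : (Finset.univ.filter fun σ : K →ₐ[ℚ] ℂ => σ ≠ σ₀ ∧ (σ θ).im = 0).Nonempty
    · obtain ⟨τ, hτ, hmin⟩ := Finset.exists_min_image _
        (fun σ : K →ₐ[ℚ] ℂ => |(σ θ).re - (σ₀ θ).re|) hne
      simp only [Finset.mem_filter, Finset.mem_univ, true_and] at hτ hmin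
      refine ⟨_, abs_pos.2 fun h => hτ.1 (hθ ?_), fun σ h1 h2 => hmin σ ⟨h1, h2⟩⟩
      exact Complex.ext (sub_eq_zero.1 h) (hτ.2.trans h₀.symm)
    · refine ⟨1, one_pos, fun σ h1 h2 => absurd ⟨σ, ?_⟩ hne⟩
      simp [h1, h2]
  obtain ⟨p, hp1, hp2⟩ := exists_rat_btwn (sub_lt_self (σ₀ θ).re hε)
  obtain ⟨q, hq1, hq2⟩ := exists_rat_btwn (lt_add_of_pos_right (σ₀ θ).re hε)
  have hσ : ∀ σ : K →ₐ[ℚ] ℂ, σ ((θ - algebraMap ℚ K p) * (θ - algebraMap ℚ K q)) =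
      (σ θ - (p : ℂ)) * (σ θ - (q : ℂ)) := fun σ => by
    simp
  have hre : ∀ σ : K →ₐ[ℚ] ℂ, (σ θ).im = 0 →
      (σ ((θ - algebraMap ℚ K p) * (θ - algebraMap ℚ K q))).re =
      ((σ θ).re - p) * ((σ θ).re - q) := fun σ h => by
    rw [hσ]
    simp [Complex.mul_re, h]
  refine ⟨(θ - algebraMap ℚ K p) * (θ - algebraMap ℚ K q), ?_,
    fun σ hne => ⟨fun h => ?_, fun h => ?_⟩⟩
  · rw [hre _ h₀]
    exact mul_neg_of_pos_of_neg (by linarith) (by linarith)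
  · rw [hre _ h]
    rcases le_abs.1 (hsep σ hne h) with h' | h'
    · exact mul_pos (by linarith) (by linarith)
    · exact mul_pos_of_neg_of_neg (by linarith) (by linarith)
  · rw [hσ]
    refine mul_ne_zero (fun h' => h ?_) (fun h' => h ?_) <;>
      simpa using congrArg Complex.im h'

/-- The sign of a polynomial with coefficients in a number field at a real embedding is detected
by the signatures of two trace forms. -/
lemma eval₂_pos_iff_signVariations_lt [Fintype ι] [DecidableEq ι] (b : Basis ι ℚ K) {θ : K}
    (hθ : Function.Injective fun σ : K →ₐ[ℚ] ℂ => σ θ) {σ₀ : K →ₐ[ℚ] ℂ} (h₀ : (σ₀ θ).im = 0)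
    {h : K} (hneg : (σ₀ h).re < 0)
    (hpos : ∀ σ : K →ₐ[ℚ] ℂ, σ ≠ σ₀ → (σ θ).im = 0 → 0 < (σ h).re)
    (hne : ∀ σ : K →ₐ[ℚ] ℂ, σ ≠ σ₀ → (σ θ).im ≠ 0 → σ h ≠ 0)
    (G : MvPolynomial (Fin n) K) (x : Fin n → ℝ) :
    0 < (eval₂ (σ₀ : K →+* ℂ) (fun i => (x i : ℂ)) G).re ↔
      (scaledTraceMatrix b fun k =>
        aeval x (coordPolynomial b (G * C h) k)).charpoly.signVariations <
      (scaledTraceMatrix b fun k => aeval x (coordPolynomial b G k)).charpoly.signVariations := by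
  rw [← (isHermitian_scaledTraceMatrix b _).sigPos_eq_signVariations_charpoly,
    ← (isHermitian_scaledTraceMatrix b _).sigPos_eq_signVariations_charpoly,
    sigPos_scaledTraceMatrix b hθ, sigPos_scaledTraceMatrix b hθ]
  simp only [realExtension_coordPolynomial, eval₂_mul, eval₂_C, RingHom.coe_coe]
  have hre : ∀ σ : K →ₐ[ℚ] ℂ, (σ θ).im = 0 →
      (eval₂ (σ : K →+* ℂ) (fun i => (x i : ℂ)) G * σ h).re =
        (eval₂ (σ : K →+* ℂ) (fun i => (x i : ℂ)) G).re * (σ h).re := fun σ hσ => by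
    have : (σ h).im = 0 := by
      rw [← Complex.conj_eq_iff_im, ← conjEmbedding_apply, conjEmbedding_eq_self hθ hσ]
    rw [Complex.mul_re, this]
    ring
  have hiff : ∀ σ : K →ₐ[ℚ] ℂ, σ ≠ σ₀ →
      (((σ θ).im = 0 ∧ 0 < (eval₂ (σ : K →+* ℂ) (fun i => (x i : ℂ)) G * σ h).re ∨
        0 < (σ θ).im ∧ eval₂ (σ : K →+* ℂ) (fun i => (x i : ℂ)) G * σ h ≠ 0) ↔
      ((σ θ).im = 0 ∧ 0 < (eval₂ (σ : K →+* ℂ) (fun i => (x i : ℂ)) G).re ∨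
        0 < (σ θ).im ∧ eval₂ (σ : K →+* ℂ) (fun i => (x i : ℂ)) G ≠ 0)) := by
    intro σ hσ
    by_cases him : (σ θ).im = 0
    · simp [him, hre σ him, mul_pos_iff_of_pos_right (hpos σ hσ him)]
    · simp [him, hne σ hσ him]
  constructor
  · intro hG
    refine Set.ncard_lt_ncard ((Set.ssubset_iff_of_subset ?_).2 ⟨σ₀, ?_, ?_⟩) (Set.toFinite _)
    · intro σ hσ
      by_cases hσ₀ : σ = σ₀
      · subst hσ₀
        exact Or.inl ⟨h₀, hG⟩
      · exact (hiff σ hσ₀).1 hσ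
    · exact Or.inl ⟨h₀, hG⟩
    · simp only [Set.mem_ofPred_eq, h₀, hre σ₀ h₀, lt_irrefl, false_and, or_false, true_and,
        not_lt]
      exact (mul_neg_of_pos_of_neg hG hneg).le
  · contrapose!
    intro hG
    refine Set.ncard_le_ncard (fun σ hσ => ?_) (Set.toFinite _)
    by_cases hσ₀ : σ = σ₀
    · subst hσ₀
      simp only [Set.mem_ofPred_eq, h₀, lt_irrefl, false_and, or_false, true_and] at hσ
      exact absurd hσ hG.not_gt
    · exact (hiff σ hσ₀).2 hσ

lemma isSemiAlgebraic_rat_eval₂_pos {θ : K}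
    (hθ : Function.Injective fun σ : K →ₐ[ℚ] ℂ => σ θ) {σ₀ : K →ₐ[ℚ] ℂ} (h₀ : (σ₀ θ).im = 0)
    (G : MvPolynomial (Fin n) K) :
    IsSemiAlgebraic ratCoeffs n
      {x | 0 < (eval₂ (σ₀ : K →+* ℂ) (fun i => (x i : ℂ)) G).re} := by
  obtain ⟨h, hneg, hsep⟩ := exists_neg_at_pos_elsewhere hθ h₀
  let b := finBasis ℚ K
  let χ : Bool → Polynomial (MvPolynomial (Fin n) ℚ) := fun c =>
    (traceMatrixPolynomial b (bif c then G else G * C h)).charpoly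
  let N : ℕ := max (χ true).natDegree (χ false).natDegree
  have hχ : ∀ H x, (scaledTraceMatrix b fun k => aeval x (coordPolynomial b H k)).charpoly =
      (traceMatrixPolynomial b H).charpoly.map
        (aeval x : MvPolynomial (Fin n) ℚ →ₐ[ℚ] ℝ).toRingHom := fun H x => by
    rw [← traceMatrixPolynomial_map, Matrix.charpoly_map]
  refine isSemiAlgebraic_rat_of_sign (ι := Bool × Fin (N + 1)) (fun i => (χ i.1).coeff i.2) ?_
  intro x hx x' hsign
  have hV : ∀ c, ((χ c).map (aeval x : MvPolynomial (Fin n) ℚ →ₐ[ℚ] ℝ).toRingHom).signVariations =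
      ((χ c).map (aeval x' : MvPolynomial (Fin n) ℚ →ₐ[ℚ] ℝ).toRingHom).signVariations := by
    refine fun c => Polynomial.signVariations_congr fun i => ?_
    rw [Polynomial.coeff_map, Polynomial.coeff_map]
    by_cases hi : i < N + 1
    · simpa using hsign (c, ⟨i, hi⟩)
    · have : (χ c).coeff i = 0 := by
        apply Polynomial.coeff_eq_zero_of_natDegree_lt
        cases c <;> simp only [N] at hi <;> omega
      simp [this]
  have hiff := eval₂_pos_iff_signVariations_lt b hθ h₀ hneg (fun σ hσ => (hsep σ hσ).1)
    (fun σ hσ => (hsep σ hσ).2) G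
  simp only [Set.mem_ofPred_eq, hiff, hχ] at hx ⊢
  have htrue := hV true
  have hfalse := hV false
  simp only [χ, cond_true, cond_false] at htrue hfalse
  rwa [← htrue, ← hfalse]

end SignDetermination

lemma isSemiAlgebraic_rat_realAlg_pos {n : ℕ} (p : MvPolynomial (Fin n) ℝ)
    (hp : ∀ m, MvPolynomial.coeff m p ∈ realAlgCoeffs) :
    IsSemiAlgebraic ratCoeffs n {x | 0 < MvPolynomial.eval x p} := by
  let S : Set ℝ := (fun m => MvPolynomial.coeff m p) '' p.support
  have : Finite S := Set.toFinite _
  let K := IntermediateField.adjoin ℚ S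
  have : FiniteDimensional ℚ K := IntermediateField.finiteDimensional_adjoin fun z hz => by
    obtain ⟨m, _, rfl⟩ := hz
    exact (hp m).isIntegral
  obtain ⟨G, hG⟩ : ∃ G : MvPolynomial (Fin n) K, MvPolynomial.map (algebraMap K ℝ) G = p := by
    rw [← Set.mem_range, MvPolynomial.mem_range_map_iff_coeffs_subset]
    intro z hz
    obtain ⟨m, hm, rfl⟩ := MvPolynomial.mem_coeffs_iff.1 hz
    exact ⟨⟨_, IntermediateField.subset_adjoin ℚ S ⟨m, hm, rfl⟩⟩, rfl⟩
  obtain ⟨θ, hθ⟩ := Field.exists_primitive_element ℚ K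
  rw [Field.primitive_element_iff_algHom_eq_of_eval' ℚ ℂ fun _ => IsAlgClosed.splits _] at hθ
  let σ₀ : K →ₐ[ℚ] ℂ := (Complex.ofRealAm.restrictScalars ℚ).comp K.val
  have h₀ : (σ₀ θ).im = 0 := Complex.ofReal_im _
  convert! isSemiAlgebraic_rat_eval₂_pos hθ h₀ G using 3 with x
  have : (MvPolynomial.eval₂ (σ₀ : K →+* ℂ) (fun i => (x i : ℂ)) G) =
      ((MvPolynomial.eval x p : ℝ) : ℂ) := by
    rw [← hG, MvPolynomial.eval_map]
    exact (MvPolynomial.eval₂_comp_left Complex.ofRealHom (algebraMap K ℝ) x G).symm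
  rw [this, Complex.ofReal_re]

/-- A subset of `ℝⁿ` is `ℚ`-semi-algebraic if and only if it is semi-algebraic over the
field `𝔔 = ℚ̄ ∩ ℝ` of real algebraic numbers. -/
theorem isSemiAlgebraic_rat_iff_realAlg (n : ℕ) (s : Set (Fin n → ℝ)) :
    IsSemiAlgebraic ratCoeffs n s ↔ IsSemiAlgebraic realAlgCoeffs n s := by
  refine ⟨.mono ?_, fun hs => ?_⟩
  · rintro _ ⟨q, rfl⟩
    exact isAlgebraic_algebraMap q
  · induction hs with
    | basic p hp => exact isSemiAlgebraic_rat_realAlg_pos p hp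
    | compl s _ ih => exact .compl n s ih
    | union s t _ _ ihs iht => exact .union n s t ihs iht
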